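/- Let q be a prime power and let f : 𝔽_q[x] → ℂ be a 1-bounded multiplicative function. Then f is aperiodic if and only if for every polynomial map l : 𝔽_q[x] → 𝔽_q of degree at most 1 and every additive character α of 𝔽_q, one has (1/q^n)·∑_{g ∈ G_n} f(g)·α(l(g)) → 0 as n → ∞. -/

import Mathlib

open Polynomial Filter

/-- The polynomial with coefficient vector `c`, an element of `G_n` (degree < n). -/
noncomputable def polyOf {F : Type*} [Semiring F] {n : ℕ} (c : Fin n → F) : Polynomial F :=
  ∑ i, Polynomial.C (c i) * Polynomial.X ^ (i : ℕ)

/-- Multiplicative function. -/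
def IsMultFn {F : Type*} [CommSemiring F] (f : Polynomial F → ℂ) : Prop :=
  ∀ g h : Polynomial F, IsCoprime g h → f (g * h) = f g * f h

/-- Aperiodic function. -/
def IsAperiodicFn {F : Type*} [Field F] [Fintype F] (f : Polynomial F → ℂ) : Prop :=
  ∀ s : Polynomial F, s ≠ 0 → ∀ a : (Polynomial F ⧸ Ideal.span {s}) → ℂ,
    Tendsto (fun n : ℕ => (1 / (Fintype.card F : ℂ) ^ n) *
        ∑ c : Fin n → F, f (polyOf c) *
          (starRingEnd ℂ) (a (Ideal.Quotient.mk (Ideal.span {s}) (polyOf c))))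
      atTop (nhds 0)

/-- Difference operator `Δ_h P (g) = P (g + h) - P g`. -/
def Δop {A M : Type*} [Add A] [Sub M] (h : A) (P : A → M) : A → M := fun g => P (g + h) - P g

/-- `P` is a polynomial map of degree at most `m`. -/
def DegLE {A M : Type*} [Add A] [AddGroup M] (P : A → M) (m : ℕ) : Prop :=
  ∀ h : Fin (m + 1) → A, ∀ g : A, (List.ofFn h).foldr Δop P g = 0

lemma coeff_polyOf {F : Type*} [Field F] {n : ℕ} (c : Fin n → F) (i : Fin n) :
    (polyOf c).coeff i = c i := by
  simp only [polyOf, finsetSum_coeff, coeff_C_mul_X_pow]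
  rw [Finset.sum_eq_single i]
  · simp
  · intro j _ hj
    rw [if_neg]
    exact fun h => hj (Fin.ext h.symm)
  · simp

lemma polyOf_injective {F : Type*} [Field F] (n : ℕ) :
    Function.Injective (polyOf : (Fin n → F) → F[X]) := by
  intro c d h
  funext i
  rw [← coeff_polyOf c i, h, coeff_polyOf]

open scoped Classical in
/-- The finite set `G_n` of polynomials of degree less than `n`. -/
noncomputable def polysLT (F : Type*) [Field F] [Fintype F] (n : ℕ) : Finset F[X] :=
  Finset.univ.image (polyOf : (Fin n → F) → F[X])

section PolysLT

variable {F : Type*} [Field F] [Fintype F]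

lemma mem_polysLT {n : ℕ} {g : F[X]} : g ∈ polysLT F n ↔ g.degree < n := by
  simp only [polysLT, Finset.mem_image, Finset.mem_univ, true_and]
  constructor
  · rintro ⟨c, rfl⟩
    exact degree_sum_fin_lt c
  · intro h
    refine ⟨fun i => g.coeff i, ?_⟩
    ext m
    by_cases hm : m < n
    · exact coeff_polyOf (fun i : Fin n => g.coeff i) ⟨m, hm⟩
    · have hm' : (n : WithBot ℕ) ≤ m := by exact_mod_cast not_lt.mp hm
      rw [coeff_eq_zero_of_degree_lt (h.trans_le hm'),
        coeff_eq_zero_of_degree_lt (p := polyOf _) ((degree_sum_fin_lt _).trans_le hm')]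

lemma card_polysLT (n : ℕ) : (polysLT F n).card = Fintype.card F ^ n := by
  classical
  rw [polysLT, Finset.card_image_of_injective _ (polyOf_injective n)]
  simp

lemma sum_polyOf {M : Type*} [AddCommMonoid M] (n : ℕ) (φ : F[X] → M) :
    ∑ c : Fin n → F, φ (polyOf c) = ∑ g ∈ polysLT F n, φ g := by
  classical
  rw [polysLT, Finset.sum_image ((polyOf_injective n).injOn)]

lemma add_mem_polysLT {n : ℕ} {g h : F[X]} (hg : g ∈ polysLT F n) (hh : h ∈ polysLT F n) :
    g + h ∈ polysLT F n := by
  rw [mem_polysLT] at *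
  exact (degree_add_le _ _).trans_lt (max_lt hg hh)

lemma sub_mem_polysLT {n : ℕ} {g h : F[X]} (hg : g ∈ polysLT F n) (hh : h ∈ polysLT F n) :
    g - h ∈ polysLT F n := by
  rw [mem_polysLT] at *
  exact (degree_sub_le _ _).trans_lt (max_lt hg hh)

lemma polysLT_mono {m n : ℕ} (h : m ≤ n) : polysLT F m ⊆ polysLT F n := by
  intro g hg
  rw [mem_polysLT] at *
  exact hg.trans_le (by exact_mod_cast h)

lemma mul_mem_polysLT_iff {A h : F[X]} (hA : A.Monic) {n : ℕ} (hn : A.natDegree ≤ n) :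
    A * h ∈ polysLT F n ↔ h ∈ polysLT F (n - A.natDegree) := by
  rw [mem_polysLT, mem_polysLT]
  by_cases h0 : h = 0
  · simp [h0]
  · have hAh : A * h ≠ 0 := mul_ne_zero hA.ne_zero h0
    rw [degree_eq_natDegree hAh, degree_eq_natDegree h0, natDegree_mul hA.ne_zero h0]
    norm_cast
    omega

open scoped Classical in
/-- Multiples of a monic `A` in `G_n` are parametrised by `G_{n - deg A}`. -/
lemma sum_polysLT_dvd {M : Type*} [AddCommMonoid M] {A : F[X]} (hA : A.Monic) {n : ℕ}
    (hn : A.natDegree ≤ n) (φ : F[X] → M) :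
    ∑ g ∈ polysLT F n with A ∣ g, φ g = ∑ h ∈ polysLT F (n - A.natDegree), φ (A * h) := by
  symm
  refine Finset.sum_bij (fun h _ => A * h) ?_ ?_ ?_ ?_
  · intro h hh
    simp [mul_mem_polysLT_iff hA hn, hh]
  · intro a _ b _ hab
    exact mul_left_cancel₀ hA.ne_zero hab
  · intro g hg
    rw [Finset.mem_filter] at hg
    obtain ⟨hg, h, rfl⟩ := hg
    exact ⟨h, (mul_mem_polysLT_iff hA hn).1 hg, rfl⟩
  · intros; rfl

variable (F) in
lemma one_lt_card_real : (1 : ℝ) < Fintype.card F := by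
  exact_mod_cast Fintype.one_lt_card

open scoped Classical in
lemma card_polysLT_dvd {A : F[X]} (hA : A.Monic) {n : ℕ} (hn : A.natDegree ≤ n) :
    (((polysLT F n).filter (A ∣ ·)).card : ℝ) =
      (Fintype.card F : ℝ) ^ n * ((Fintype.card F : ℝ) ^ A.natDegree)⁻¹ := by
  have h := sum_polysLT_dvd hA hn (fun _ => 1)
  simp only [Finset.sum_const, smul_eq_mul, mul_one, card_polysLT] at h
  rw [h]
  push_cast
  rw [pow_sub₀ _ (by have := one_lt_card_real F; positivity) hn]

open scoped Classical in
/-- An affine condition modulo an irreducible `P` cuts out at most `q ^ (n - deg P)` elements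
of `G_n`. -/
lemma card_polysLT_affine_dvd_le {P M : F[X]} (hP : P.Monic) (hPi : Irreducible P)
    (hPM : ¬ P ∣ M) (n : ℕ) :
    ((polysLT F n).filter (P ∣ 1 + M * ·)).card ≤ Fintype.card F ^ (n - P.natDegree) := by
  rw [← card_polysLT]
  refine Finset.card_le_card_of_injOn (fun h => h /ₘ P) ?_ ?_
  · intro h hh
    rw [Finset.mem_coe, Finset.mem_filter] at hh
    rw [Finset.mem_coe]
    by_cases hd : P.degree ≤ h.degree
    · have hn : P.natDegree ≤ n := by
        have := hd.trans_lt (mem_polysLT.1 hh.1)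
        rw [degree_eq_natDegree hP.ne_zero] at this
        exact_mod_cast this.le
      rw [← mul_mem_polysLT_iff hP hn, mem_polysLT]
      have h0 : h = h %ₘ P + P * (h /ₘ P) := (modByMonic_add_div h P).symm
      have h1 : P * (h /ₘ P) = h - h %ₘ P := by linear_combination -h0
      rw [h1]
      refine (degree_sub_le _ _).trans_lt (max_lt (mem_polysLT.1 hh.1) ?_)
      exact (degree_modByMonic_lt h hP).trans_le (hd.trans (mem_polysLT.1 hh.1).le)
    · rw [not_le] at hd
      simp only [(divByMonic_eq_zero_iff hP).2 hd]
      simp [mem_polysLT]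
  · intro a ha b hb hab
    simp only [Finset.coe_filter, Set.mem_ofPred_eq] at ha hb hab
    have h1 : P ∣ M * (a - b) := by
      have := dvd_sub ha.2 hb.2
      rwa [show 1 + M * a - (1 + M * b) = M * (a - b) by ring] at this
    have h2 : P ∣ a - b := (hPi.prime.dvd_or_dvd h1).resolve_left hPM
    have h3 : a - b = a %ₘ P - b %ₘ P := by
      conv_lhs => rw [← modByMonic_add_div a P, ← modByMonic_add_div b P, hab]
      ring
    have h4 : a - b = 0 := by
      by_contra hne
      have := degree_le_of_dvd h2 hne
      rw [h3] at this
      exact absurd ((degree_sub_le _ _).trans_lt (max_lt (degree_modByMonic_lt a hP)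
        (degree_modByMonic_lt b hP))) (not_lt.2 this)
    exact sub_eq_zero.1 h4

end PolysLT

section PrimeSum

variable (F : Type*) [Field F] [Fintype F]

/-- The sum of `1 / |P|` over monic irreducible polynomials `P` diverges. -/
theorem not_summable_monic_irreducible :
    ¬ Summable fun P : {P : F[X] // P.Monic ∧ Irreducible P} =>
      ((Fintype.card F : ℝ) ^ P.1.natDegree)⁻¹ := by
  classical
  intro hs
  have hq := one_lt_card_real F
  set q : ℝ := (Fintype.card F : ℝ) with hqdef
  have hq0 : 0 < q := by linarith
  rw [summable_iff_vanishing_norm] at hs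
  obtain ⟨T, hT⟩ := hs (1 / 4) (by norm_num)
  set M : F[X] := X * ∏ P ∈ T, P.1 with hM
  have hMm : M.Monic := monic_X.mul (monic_prod_of_monic _ _ fun P _ => P.2.1)
  obtain ⟨T', hT'⟩ := hs (1 / 4 * (q ^ M.natDegree)⁻¹) (by positivity)
  obtain ⟨n, hn2, hn⟩ : ∃ n : ℕ, 2 ≤ n ∧ ∀ P ∈ T', P.1.natDegree ≤ n :=
    ⟨max 2 (T'.sup fun P => P.1.natDegree), le_max_left _ _, fun P hP =>
      (Finset.le_sup (f := fun P => P.1.natDegree) hP).trans (le_max_right _ _)⟩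
  -- the relevant irreducibles of degree at most `n + deg M`
  set U : Finset {P : F[X] // P.Monic ∧ Irreducible P} :=
    (polysLT F (n + M.natDegree + 1)).subtype _ with hU
  set B : {P : F[X] // P.Monic ∧ Irreducible P} → Finset F[X] := fun P =>
    (polysLT F n).filter (P.1 ∣ 1 + M * ·) with hB
  have hMX : 1 ≤ M.natDegree := by
    rw [hM, natDegree_mul X_ne_zero
      (Finset.prod_ne_zero_iff.2 fun P _ => P.2.1.ne_zero), natDegree_X]
    omega
  have hcover : (polysLT F n).erase 0 ⊆ ((U.filter (fun P => ¬ P.1 ∣ M))).biUnion B := by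
    intro h hh
    obtain ⟨h0, hmem⟩ := Finset.mem_erase.1 hh
    have hMh : M * h ≠ 0 := mul_ne_zero hMm.ne_zero h0
    have hdeg : (M * h).natDegree = M.natDegree + h.natDegree :=
      natDegree_mul hMm.ne_zero h0
    have hdeg' : (1 + M * h).natDegree = M.natDegree + h.natDegree := by
      rw [natDegree_add_eq_right_of_natDegree_lt, hdeg]
      rw [natDegree_one, hdeg]; omega
    obtain ⟨P, hPm, hPi, hPd⟩ := exists_monic_irreducible_factor (1 + M * h)
      (not_isUnit_of_natDegree_pos _ (by omega))
    have hne : 1 + M * h ≠ 0 := by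
      intro h1; rw [h1, natDegree_zero] at hdeg'; omega
    have hPle := natDegree_le_of_dvd hPd hne
    have hhn : h.natDegree < n := by
      have := mem_polysLT.1 hmem
      rw [degree_eq_natDegree h0] at this
      exact_mod_cast this
    rw [Finset.mem_biUnion]
    refine ⟨⟨P, hPm, hPi⟩, ?_, ?_⟩
    · rw [Finset.mem_filter, hU, Finset.mem_subtype, mem_polysLT]
      refine ⟨?_, ?_⟩
      · rw [degree_eq_natDegree hPi.ne_zero]
        exact_mod_cast (by omega : P.natDegree < n + M.natDegree + 1)
      · intro hPM
        refine hPi.not_isUnit (isUnit_of_dvd_one ?_)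
        exact (dvd_add_left (hPM.mul_right h)).1 hPd
    · rw [hB, Finset.mem_filter]
      exact ⟨hmem, hPd⟩
  have hcard := (Finset.card_le_card hcover).trans Finset.card_biUnion_le
  rw [Finset.card_erase_of_mem (by simp [mem_polysLT]), card_polysLT] at hcard
  set V := U.filter (fun P => ¬ P.1 ∣ M) with hV
  have hVT : ∀ P ∈ V, P ∉ T := by
    intro P hP hPT
    exact (Finset.mem_filter.1 hP).2 ((Finset.dvd_prod_of_mem (fun P => P.1) hPT).mul_left X)
  have hbound : ∀ P ∈ V, ((B P).card : ℝ) ≤ q ^ n * (q ^ P.1.natDegree)⁻¹ +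
      if n < P.1.natDegree then q ^ (n + M.natDegree) * (q ^ P.1.natDegree)⁻¹ else 0 := by
    intro P hP
    have h1 : ((B P).card : ℝ) ≤ q ^ (n - P.1.natDegree) := by
      rw [hqdef]
      exact_mod_cast card_polysLT_affine_dvd_le P.2.1 P.2.2 (Finset.mem_filter.1 hP).2 n
    have hpos : 0 < q ^ n * (q ^ P.1.natDegree)⁻¹ := by positivity
    split_ifs with h
    · rw [Nat.sub_eq_zero_of_le h.le, pow_zero] at h1
      have hPd : P.1.natDegree ≤ n + M.natDegree := by
        have := mem_polysLT.1 (Finset.mem_subtype.1 (Finset.mem_filter.1 hP).1)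
        rw [degree_eq_natDegree P.2.1.ne_zero] at this
        have : P.1.natDegree < n + M.natDegree + 1 := by exact_mod_cast this
        omega
      have : 1 ≤ q ^ (n + M.natDegree) * (q ^ P.1.natDegree)⁻¹ := by
        rw [← div_eq_mul_inv, one_le_div (by positivity)]
        exact pow_le_pow_right₀ hq.le hPd
      linarith
    · rw [pow_sub₀ _ hq0.ne' (by omega)] at h1
      linarith
  have hsum : ((∑ P ∈ V, (B P).card : ℕ) : ℝ) ≤
      q ^ n * ∑ P ∈ V, (q ^ P.1.natDegree)⁻¹ + q ^ (n + M.natDegree) *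
        ∑ P ∈ V with n < P.1.natDegree, (q ^ P.1.natDegree)⁻¹ := by
    push_cast
    refine (Finset.sum_le_sum hbound).trans (le_of_eq ?_)
    rw [Finset.sum_add_distrib, ← Finset.sum_filter, Finset.mul_sum, Finset.mul_sum]
  have t1 := (le_abs_self _).trans_lt (hT V (Finset.disjoint_left.2 hVT))
  have t2 := (le_abs_self _).trans_lt (hT' (V.filter fun P => n < P.1.natDegree)
    (Finset.disjoint_left.2 fun P hP hP' =>
      absurd (hn P hP') (not_le.2 (Finset.mem_filter.1 hP).2)))
  have hcard' : q ^ n - 1 ≤ ((∑ P ∈ V, (B P).card : ℕ) : ℝ) := by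
    have : Fintype.card F ^ n ≤ ∑ P ∈ V, (B P).card + 1 := by omega
    have : (q ^ n : ℝ) ≤ ((∑ P ∈ V, (B P).card : ℕ) : ℝ) + 1 := by
      rw [hqdef]
      exact_mod_cast this
    linarith
  have hqn : (4 : ℝ) ≤ q ^ n := by
    have h2 : (2 : ℝ) ≤ q := by
      rw [hqdef]
      exact_mod_cast Fintype.one_lt_card (α := F)
    calc (4 : ℝ) = 2 ^ 2 := by norm_num
      _ ≤ q ^ 2 := by gcongr
      _ ≤ q ^ n := pow_le_pow_right₀ hq.le hn2
  have e1 : q ^ n * ∑ P ∈ V, (q ^ P.1.natDegree)⁻¹ ≤ q ^ n * (1 / 4) := by gcongr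
  have e2 : q ^ (n + M.natDegree) * ∑ P ∈ V with n < P.1.natDegree, (q ^ P.1.natDegree)⁻¹ ≤
      q ^ n * (1 / 4) := by
    calc _ ≤ q ^ (n + M.natDegree) * (1 / 4 * (q ^ M.natDegree)⁻¹) := by gcongr
      _ = q ^ n * (1 / 4) := by rw [pow_add]; field_simp
  linarith

/-- There are finite sets of monic irreducibles of large degree with `∑ 1 / |P|` large. -/
theorem exists_monic_irreducible_sum_ge (D : ℕ) (W : ℝ) :
    ∃ T : Finset F[X], (∀ P ∈ T, P.Monic ∧ Irreducible P ∧ D ≤ P.natDegree) ∧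
      W ≤ ∑ P ∈ T, ((Fintype.card F : ℝ) ^ P.natDegree)⁻¹ := by
  classical
  by_contra! hcon
  refine not_summable_monic_irreducible F (summable_of_sum_le (c :=
    W + ∑ P ∈ polysLT F D, ((Fintype.card F : ℝ) ^ P.natDegree)⁻¹) (fun _ => by positivity) ?_)
  intro u
  set T := u.map ⟨Subtype.val, Subtype.val_injective⟩ with hT
  have hTu : ∀ P ∈ T, P.Monic ∧ Irreducible P := by
    intro P hP
    obtain ⟨Q, _, rfl⟩ := Finset.mem_map.1 hP
    exact Q.2
  have h1 : ∑ P ∈ u, ((Fintype.card F : ℝ) ^ P.1.natDegree)⁻¹ =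
      ∑ P ∈ T, ((Fintype.card F : ℝ) ^ P.natDegree)⁻¹ := by
    rw [hT, Finset.sum_map]; rfl
  rw [h1, ← Finset.sum_filter_add_sum_filter_not T (fun P => D ≤ P.natDegree)]
  refine add_le_add (hcon _ ?_).le ?_
  · intro P hP
    obtain ⟨hP, hD⟩ := Finset.mem_filter.1 hP
    exact ⟨(hTu P hP).1, (hTu P hP).2, hD⟩
  · refine Finset.sum_le_sum_of_subset_of_nonneg ?_ (fun _ _ _ => by positivity)
    intro P hP
    obtain ⟨hP, hD⟩ := Finset.mem_filter.1 hP
    rw [mem_polysLT, degree_eq_natDegree (hTu P hP).1.ne_zero]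
    exact_mod_cast not_le.1 hD

end PrimeSum

open scoped ComplexConjugate

/-- A bounded weight has small correlation with a sum of orthogonal functions. -/
lemma norm_sum_mul_sum_orthogonal_sq_le {ι X : Type*} (G : Finset X) (T : Finset ι)
    (u : ι → X → ℂ) (w : X → ℂ) (b : ι → ℝ) (hw : ∀ g, ‖w g‖ ≤ 1)
    (horth : ∀ P ∈ T, ∀ Q ∈ T, P ≠ Q → ∑ g ∈ G, u P g * conj (u Q g) = 0)
    (hb : ∀ P ∈ T, ∑ g ∈ G, ‖u P g‖ ^ 2 ≤ b P) :
    ‖∑ g ∈ G, w g * ∑ P ∈ T, u P g‖ ^ 2 ≤ G.card * ∑ P ∈ T, b P := by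
  classical
  have h1 : ‖∑ g ∈ G, w g * ∑ P ∈ T, u P g‖ ≤ ∑ g ∈ G, ‖∑ P ∈ T, u P g‖ := by
    refine (norm_sum_le _ _).trans (Finset.sum_le_sum fun g _ => ?_)
    rw [norm_mul]
    exact mul_le_of_le_one_left (norm_nonneg _) (hw g)
  have h2 : ∑ g ∈ G, ‖∑ P ∈ T, u P g‖ ^ 2 = ∑ P ∈ T, ∑ g ∈ G, ‖u P g‖ ^ 2 := by
    have key : ∀ z : ℂ, ((‖z‖ ^ 2 : ℝ) : ℂ) = z * conj z := fun z => by
      rw [Complex.mul_conj, Complex.normSq_eq_norm_sq]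
    have : ((∑ g ∈ G, ‖∑ P ∈ T, u P g‖ ^ 2 : ℝ) : ℂ) =
        ((∑ P ∈ T, ∑ g ∈ G, ‖u P g‖ ^ 2 : ℝ) : ℂ) := by
      rw [Complex.ofReal_sum, Complex.ofReal_sum]
      simp_rw [key, map_sum, Finset.sum_mul_sum]
      rw [Finset.sum_comm]
      refine Finset.sum_congr rfl fun P hP => ?_
      rw [Finset.sum_comm, Finset.sum_eq_single P, Complex.ofReal_sum]
      · simp_rw [key]
      · exact fun Q hQ hne => horth P hP Q hQ hne.symm
      · exact fun h => absurd hP h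
    exact_mod_cast this
  calc ‖∑ g ∈ G, w g * ∑ P ∈ T, u P g‖ ^ 2 ≤ (∑ g ∈ G, ‖∑ P ∈ T, u P g‖) ^ 2 := by gcongr
    _ ≤ G.card * ∑ g ∈ G, ‖∑ P ∈ T, u P g‖ ^ 2 := sq_sum_le_card_mul_sum_sq
    _ ≤ G.card * ∑ P ∈ T, b P := by
      rw [h2]
      gcongr with P hP
      exact hb P hP

section Katai

variable {F : Type*} [Field F] [Fintype F]

open scoped Classical in
/-- Turán–Kubilius inequality in weighted form: the number of prime divisors from `T` is close
to its mean. -/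
lemma turan_kubilius (T : Finset F[X]) (hT : ∀ P ∈ T, P.Monic ∧ Irreducible P) {n : ℕ}
    (hn : ∀ P ∈ T, ∀ Q ∈ T, P.natDegree + Q.natDegree ≤ n) (w : F[X] → ℂ)
    (hw : ∀ g, ‖w g‖ ≤ 1) :
    ‖∑ g ∈ polysLT F n, w g * ∑ P ∈ T, ((((if P ∣ g then 1 else 0) -
        ((Fintype.card F : ℝ) ^ P.natDegree)⁻¹ : ℝ)) : ℂ)‖ ^ 2 ≤
      ((Fintype.card F : ℝ) ^ n) ^ 2 * ∑ P ∈ T, ((Fintype.card F : ℝ) ^ P.natDegree)⁻¹ := by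
  have hq := one_lt_card_real F
  have hind : ∀ A : F[X], A.Monic → A.natDegree ≤ n →
      ∑ g ∈ polysLT F n, (if A ∣ g then (1 : ℝ) else 0) =
        (Fintype.card F : ℝ) ^ n * ((Fintype.card F : ℝ) ^ A.natDegree)⁻¹ := by
    intro A hA hAn
    rw [← card_polysLT_dvd hA hAn, Finset.sum_boole]
  have h := norm_sum_mul_sum_orthogonal_sq_le (polysLT F n) T
    (fun P g => ((((if P ∣ g then 1 else 0) -
        ((Fintype.card F : ℝ) ^ P.natDegree)⁻¹ : ℝ)) : ℂ)) w
    (fun P => (Fintype.card F : ℝ) ^ n * ((Fintype.card F : ℝ) ^ P.natDegree)⁻¹) hw ?_ ?_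
  · rw [card_polysLT, ← Finset.mul_sum] at h
    refine h.trans (le_of_eq ?_)
    push_cast
    ring
  · intro P hP Q hQ hne
    simp only [Complex.conj_ofReal, ← Complex.ofReal_mul]
    rw [← Complex.ofReal_sum, Complex.ofReal_eq_zero]
    have hco : IsCoprime P Q := by
      refine (hT P hP).2.coprime_iff_not_dvd.2 fun hd => hne ?_
      exact eq_of_monic_of_associated (hT P hP).1 (hT Q hQ).1
        ((hT P hP).2.associated_of_dvd (hT Q hQ).2 hd)
    have hPQ : ∀ g : F[X], ((if P ∣ g then (1 : ℝ) else 0) * if Q ∣ g then 1 else 0) =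
        if P * Q ∣ g then 1 else 0 := by
      intro g
      have : P * Q ∣ g ↔ P ∣ g ∧ Q ∣ g :=
        ⟨fun h => ⟨(dvd_mul_right _ _).trans h, (dvd_mul_left _ _).trans h⟩,
          fun h => hco.mul_dvd h.1 h.2⟩
      by_cases h1 : P ∣ g <;> by_cases h2 : Q ∣ g <;> simp [this, h1, h2]
    have hPn := hn P hP Q hQ
    have e1 := hind P (hT P hP).1 (by omega)
    have e2 := hind Q (hT Q hQ).1 (by omega)
    have e3 := hind (P * Q) ((hT P hP).1.mul (hT Q hQ).1)
      (by rwa [(hT P hP).1.natDegree_mul (hT Q hQ).1])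
    rw [(hT P hP).1.natDegree_mul (hT Q hQ).1, pow_add, mul_inv] at e3
    simp_rw [sub_mul, mul_sub, hPQ]
    rw [Finset.sum_sub_distrib, Finset.sum_sub_distrib, Finset.sum_sub_distrib, e3,
      ← Finset.sum_mul, ← Finset.mul_sum, e1, e2, Finset.sum_const, card_polysLT, nsmul_eq_mul]
    push_cast
    ring
  · intro P hP
    have e1 := hind P (hT P hP).1 (by have := hn P hP P hP; omega)
    set a := ((Fintype.card F : ℝ) ^ P.natDegree)⁻¹ with ha
    have : ∀ g : F[X], ‖(((if P ∣ g then 1 else 0) - a : ℝ) : ℂ)‖ ^ 2 =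
        (1 - 2 * a) * (if P ∣ g then 1 else 0) + a ^ 2 := by
      intro g
      rw [Complex.norm_real, Real.norm_eq_abs, sq_abs]
      split_ifs <;> ring
    simp_rw [this]
    rw [Finset.sum_add_distrib, ← Finset.mul_sum, e1, Finset.sum_const, card_polysLT,
      nsmul_eq_mul]
    push_cast
    have : 0 ≤ (Fintype.card F : ℝ) ^ n * a ^ 2 := by positivity
    linarith

/-- A character nontrivial on `G_n` sums to zero over it. -/
lemma sum_polysLT_eq_zero (ψ : AddChar F[X] ℂ) {n : ℕ} {h : F[X]} (hh : h ∈ polysLT F n)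
    (hψ : ψ h ≠ 1) : ∑ g ∈ polysLT F n, ψ g = 0 := by
  have e : ∑ g ∈ polysLT F n, ψ (h + g) = ∑ g ∈ polysLT F n, ψ g :=
    Finset.sum_bij' (fun g _ => h + g) (fun g _ => g - h)
      (fun g hg => add_mem_polysLT hh hg) (fun g hg => sub_mem_polysLT hg hh)
      (fun g _ => by ring) (fun g _ => by ring) (fun _ _ => rfl)
  simp_rw [AddChar.map_add_eq_mul, ← Finset.mul_sum] at e
  exact eq_zero_of_mul_eq_self_left hψ e

/-- The bilinear step: distinct dilates of `χ` are orthogonal on `G_n`. -/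
lemma norm_sum_dilates_sq_le (χ : AddChar F[X] ℂ) (hχ : ∀ g, ‖χ g‖ = 1) (f : F[X] → ℂ)
    (hf : ∀ g, ‖f g‖ ≤ 1) (T : Finset F[X]) {n : ℕ} (hn : ∀ P ∈ T, P.natDegree ≤ n)
    (hzero : ∀ P ∈ T, ∀ Q ∈ T, P ≠ Q →
      ∑ h ∈ polysLT F (n - max P.natDegree Q.natDegree), χ ((P - Q) * h) = 0) :
    ‖∑ P ∈ T, ∑ h ∈ polysLT F (n - P.natDegree), f h * (f P * χ (P * h))‖ ^ 2 ≤
      ((Fintype.card F : ℝ) ^ n) ^ 2 * ∑ P ∈ T, ((Fintype.card F : ℝ) ^ P.natDegree)⁻¹ := by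
  classical
  have hq := one_lt_card_real F
  have hfil : ∀ m, m ≤ n → (polysLT F n).filter (· ∈ polysLT F m) = polysLT F m := by
    intro m hm
    ext g
    rw [Finset.mem_filter]
    exact ⟨And.right, fun h => ⟨polysLT_mono hm h, h⟩⟩
  have h := norm_sum_mul_sum_orthogonal_sq_le (polysLT F n) T
    (fun P h => if h ∈ polysLT F (n - P.natDegree) then f P * χ (P * h) else 0) f
    (fun P => (Fintype.card F : ℝ) ^ n * ((Fintype.card F : ℝ) ^ P.natDegree)⁻¹) hf ?_ ?_
  · rw [card_polysLT, ← Finset.mul_sum] at h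
    have e : ∑ g ∈ polysLT F n, f g * ∑ P ∈ T,
        (if g ∈ polysLT F (n - P.natDegree) then f P * χ (P * g) else 0) =
        ∑ P ∈ T, ∑ h ∈ polysLT F (n - P.natDegree), f h * (f P * χ (P * h)) := by
      simp_rw [Finset.mul_sum]
      rw [Finset.sum_comm]
      refine Finset.sum_congr rfl fun P _ => ?_
      simp_rw [mul_ite, mul_zero]
      rw [← Finset.sum_filter, hfil _ (Nat.sub_le _ _)]
    rw [e] at h
    refine h.trans (le_of_eq ?_)
    push_cast
    ring
  · intro P hP Q hQ hne
    have hχc : ∀ g h : F[X], χ g * conj (χ h) = χ (g - h) := by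
      intro g h
      rw [sub_eq_add_neg, AddChar.map_add_eq_mul, AddChar.map_neg_eq_inv,
        Complex.inv_eq_conj (hχ h)]
    have e : ∀ g : F[X], (if g ∈ polysLT F (n - P.natDegree) then f P * χ (P * g) else 0) *
        conj (if g ∈ polysLT F (n - Q.natDegree) then f Q * χ (Q * g) else 0) =
        if g ∈ polysLT F (n - max P.natDegree Q.natDegree) then
          f P * conj (f Q) * χ ((P - Q) * g) else 0 := by
      intro g
      have hiff : g ∈ polysLT F (n - max P.natDegree Q.natDegree) ↔
          g ∈ polysLT F (n - P.natDegree) ∧ g ∈ polysLT F (n - Q.natDegree) := by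
        refine ⟨fun h => ⟨polysLT_mono (by omega) h, polysLT_mono (by omega) h⟩, ?_⟩
        rintro ⟨h1, h2⟩
        rcases le_total P.natDegree Q.natDegree with h | h
        · rwa [max_eq_right h]
        · rwa [max_eq_left h]
      rw [sub_mul, ← hχc]
      by_cases h1 : g ∈ polysLT F (n - P.natDegree) <;>
        by_cases h2 : g ∈ polysLT F (n - Q.natDegree) <;> simp [hiff, h1, h2]
      ring
    simp_rw [e]
    rw [← Finset.sum_filter, hfil _ (Nat.sub_le _ _), ← Finset.mul_sum, hzero P hP Q hQ hne,
      mul_zero]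
  · intro P hP
    calc _ ≤ ∑ g ∈ polysLT F n, if g ∈ polysLT F (n - P.natDegree) then (1 : ℝ) else 0 := by
          refine Finset.sum_le_sum fun g _ => ?_
          split_ifs
          · rw [norm_mul, hχ, mul_one]
            exact pow_le_one₀ (norm_nonneg _) (hf P)
          · simp
      _ = _ := by
          rw [Finset.sum_boole, hfil _ (Nat.sub_le _ _), card_polysLT]
          push_cast
          rw [pow_sub₀ _ (by positivity) (hn P hP)]

/-- Replacing `f (P * h)` by `f P * f h` costs little. -/
lemma norm_sum_mul_sub_le (f : F[X] → ℂ) (hf : IsMultFn f) (hfb : ∀ g, ‖f g‖ ≤ 1)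
    (χ : F[X] → ℂ) (hχ : ∀ g, ‖χ g‖ = 1) {P : F[X]} (hP : P.Monic) (hPi : Irreducible P) {n : ℕ}
    (hn : P.natDegree + P.natDegree ≤ n) :
    ‖∑ h ∈ polysLT F (n - P.natDegree), f (P * h) * χ (P * h) -
        ∑ h ∈ polysLT F (n - P.natDegree), f h * (f P * χ (P * h))‖ ≤
      2 * (Fintype.card F : ℝ) ^ n * (((Fintype.card F : ℝ) ^ P.natDegree)⁻¹) ^ 2 := by
  classical
  have hq := one_lt_card_real F
  rw [← Finset.sum_sub_distrib]
  calc _ ≤ ∑ h ∈ polysLT F (n - P.natDegree), if P ∣ h then (2 : ℝ) else 0 := by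
        refine (norm_sum_le _ _).trans (Finset.sum_le_sum fun h _ => ?_)
        split_ifs with hd
        · refine (norm_sub_le _ _).trans ?_
          rw [norm_mul, norm_mul, norm_mul, hχ, mul_one, mul_one]
          have := hfb (P * h)
          have := mul_le_one₀ (hfb h) (norm_nonneg _) (hfb P)
          linarith
        · rw [hf P h (hPi.coprime_iff_not_dvd.2 hd)]
          refine le_of_eq (norm_eq_zero.2 ?_)
          ring
    _ = _ := by
        rw [← Finset.sum_filter, Finset.sum_const, nsmul_eq_mul,
          card_polysLT_dvd hP (by omega), pow_sub₀ _ (by positivity) (by omega)]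
        ring

/-- Quantitative form of Kátai's orthogonality criterion for a character. -/
lemma katai_bound (f : F[X] → ℂ) (hf : IsMultFn f) (hfb : ∀ g, ‖f g‖ ≤ 1)
    (χ : AddChar F[X] ℂ) (hχ : ∀ g, ‖χ g‖ = 1) (T : Finset F[X])
    (hT : ∀ P ∈ T, P.Monic ∧ Irreducible P) {n : ℕ}
    (hn : ∀ P ∈ T, ∀ Q ∈ T, P.natDegree + Q.natDegree ≤ n)
    (hzero : ∀ P ∈ T, ∀ Q ∈ T, P ≠ Q →
      ∑ h ∈ polysLT F (n - max P.natDegree Q.natDegree), χ ((P - Q) * h) = 0) :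
    (∑ P ∈ T, ((Fintype.card F : ℝ) ^ P.natDegree)⁻¹) * ‖∑ g ∈ polysLT F n, f g * χ g‖ ≤
      (Fintype.card F : ℝ) ^ n * (2 * √(∑ P ∈ T, ((Fintype.card F : ℝ) ^ P.natDegree)⁻¹) +
        2 * ∑ P ∈ T, (((Fintype.card F : ℝ) ^ P.natDegree)⁻¹) ^ 2) := by
  classical
  have hq := one_lt_card_real F
  have hn' : ∀ P ∈ T, P.natDegree ≤ n := fun P hP => by have := hn P hP P hP; omega
  have hA := turan_kubilius T hT hn (fun g => f g * χ g)
    (fun g => by rw [norm_mul, hχ, mul_one]; exact hfb g)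
  have hB := norm_sum_dilates_sq_le χ hχ f hfb T hn' hzero
  set W := ∑ P ∈ T, ((Fintype.card F : ℝ) ^ P.natDegree)⁻¹ with hW
  have hW0 : 0 ≤ W := Finset.sum_nonneg fun _ _ => by positivity
  have hsq : ((Fintype.card F : ℝ) ^ n) ^ 2 * W = ((Fintype.card F : ℝ) ^ n * √W) ^ 2 := by
    rw [mul_pow, Real.sq_sqrt hW0]
  rw [hsq] at hA hB
  replace hA := (sq_le_sq₀ (norm_nonneg _) (by positivity)).1 hA
  replace hB := (sq_le_sq₀ (norm_nonneg _) (by positivity)).1 hB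
  have hC : ‖∑ P ∈ T, ∑ h ∈ polysLT F (n - P.natDegree), f (P * h) * χ (P * h) -
      ∑ P ∈ T, ∑ h ∈ polysLT F (n - P.natDegree), f h * (f P * χ (P * h))‖ ≤
      ∑ P ∈ T, 2 * (Fintype.card F : ℝ) ^ n * (((Fintype.card F : ℝ) ^ P.natDegree)⁻¹) ^ 2 := by
    rw [← Finset.sum_sub_distrib]
    exact (norm_sum_le _ _).trans (Finset.sum_le_sum fun P hP =>
      norm_sum_mul_sub_le f hf hfb χ hχ (hT P hP).1 (hT P hP).2 (hn P hP P hP))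
  have hsplit : ∑ g ∈ polysLT F n, f g * χ g * ∑ P ∈ T, ((((if P ∣ g then 1 else 0) -
        ((Fintype.card F : ℝ) ^ P.natDegree)⁻¹ : ℝ)) : ℂ) =
      ∑ P ∈ T, ∑ h ∈ polysLT F (n - P.natDegree), f (P * h) * χ (P * h) -
        W * ∑ g ∈ polysLT F n, f g * χ g := by
    have e1 : ∀ P ∈ T, ∑ h ∈ polysLT F (n - P.natDegree), f (P * h) * χ (P * h) =
        ∑ g ∈ polysLT F n, f g * χ g * if P ∣ g then 1 else 0 := by
      intro P hP
      rw [← sum_polysLT_dvd (hT P hP).1 (hn' P hP) (fun g => f g * χ g), Finset.sum_filter]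
      simp
    rw [Finset.sum_congr rfl e1, Finset.sum_comm, Finset.mul_sum, ← Finset.sum_sub_distrib]
    refine Finset.sum_congr rfl fun g _ => ?_
    have e2 : ∑ P ∈ T, ((((if P ∣ g then 1 else 0) -
        ((Fintype.card F : ℝ) ^ P.natDegree)⁻¹ : ℝ)) : ℂ) =
        ∑ P ∈ T, (if P ∣ g then (1 : ℂ) else 0) - W := by
      rw [hW, Complex.ofReal_sum, ← Finset.sum_sub_distrib]
      refine Finset.sum_congr rfl fun P _ => ?_
      split_ifs <;> simp
    rw [e2, ← Finset.mul_sum]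
    ring
  rw [hsplit] at hA
  rw [← Finset.mul_sum] at hC
  set S := ∑ g ∈ polysLT F n, f g * χ g
  set Y := ∑ P ∈ T, ∑ h ∈ polysLT F (n - P.natDegree), f (P * h) * χ (P * h)
  set Z := ∑ P ∈ T, ∑ h ∈ polysLT F (n - P.natDegree), f h * (f P * χ (P * h))
  have hWS : W * ‖S‖ = ‖(W : ℂ) * S‖ := by
    rw [norm_mul, Complex.norm_real, Real.norm_of_nonneg hW0]
  have hdec : (W : ℂ) * S = -(Y - W * S) + (Y - Z) + Z := by ring
  rw [hWS, hdec]
  refine (norm_add₃_le).trans ?_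
  rw [norm_neg]
  linarith

/-- A bounded multiplicative function is uncorrelated with every character that is nontrivial
on each nonzero ideal. -/
theorem tendsto_of_nonperiodic (f : F[X] → ℂ) (hf : IsMultFn f) (hfb : ∀ g, ‖f g‖ ≤ 1)
    (χ : AddChar F[X] ℂ) (hχ : ∀ g, ‖χ g‖ = 1) (hper : ∀ s : F[X], s ≠ 0 → ∃ h, χ (s * h) ≠ 1) :
    Tendsto (fun n : ℕ => (1 / (Fintype.card F : ℂ) ^ n) * ∑ g ∈ polysLT F n, f g * χ g)
      atTop (nhds 0) := by
  classical
  have hq := one_lt_card_real F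
  rw [Metric.tendsto_atTop]
  intro ε hε
  obtain ⟨D, hD⟩ := exists_pow_lt_of_lt_one (show 0 < ε / 8 by positivity)
    (inv_lt_one_of_one_lt₀ hq)
  obtain ⟨T, hT, hTW⟩ := exists_monic_irreducible_sum_ge F D ((8 / ε) ^ 2)
  have hper' : ∀ s : F[X], ∃ h, s ≠ 0 → χ (s * h) ≠ 1 := fun s => by
    by_cases hs : s = 0
    · exact ⟨0, fun h => absurd hs h⟩
    · exact (hper s hs).imp fun _ h _ => h
  choose k hk using hper'
  obtain ⟨d, hd⟩ := (T.image natDegree).exists_le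
  replace hd : ∀ P ∈ T, P.natDegree ≤ d := fun P hP => hd _ (Finset.mem_image_of_mem _ hP)
  obtain ⟨m, hm⟩ := ((T ×ˢ T).image fun x => (k (x.1 - x.2)).natDegree + 1).exists_le
  replace hm : ∀ P ∈ T, ∀ Q ∈ T, (k (P - Q)).natDegree + 1 ≤ m := fun P hP Q hQ =>
    hm _ (Finset.mem_image.2 ⟨(P, Q), Finset.mk_mem_product hP hQ, rfl⟩)
  refine ⟨2 * d + m, fun n hn => ?_⟩
  have hb := katai_bound f hf hfb χ hχ T (fun P hP => ⟨(hT P hP).1, (hT P hP).2.1⟩) (n := n)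
    (fun P hP Q hQ => by have := hd P hP; have := hd Q hQ; omega) ?_
  · set W := ∑ P ∈ T, ((Fintype.card F : ℝ) ^ P.natDegree)⁻¹ with hW
    have hsq : 8 / ε ≤ √W := Real.le_sqrt_of_sq_le hTW
    have h8 : 0 < 8 / ε := by positivity
    have hWpos : 0 < W := lt_of_lt_of_le (by positivity) hTW
    have hsmall : ∑ P ∈ T, (((Fintype.card F : ℝ) ^ P.natDegree)⁻¹) ^ 2 ≤ ε / 8 * W := by
      rw [hW, Finset.mul_sum]
      refine Finset.sum_le_sum fun P hP => ?_
      rw [sq]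
      gcongr
      refine le_trans ?_ hD.le
      rw [inv_pow]
      gcongr
      · exact hq.le
      · exact (hT P hP).2.2
    have hsqW : √W ≤ ε / 8 * W := by
      have h1 : 1 ≤ ε / 8 * √W := by
        calc (1 : ℝ) = ε / 8 * (8 / ε) := by field_simp
          _ ≤ _ := by gcongr
      calc √W ≤ ε / 8 * √W * √W := le_mul_of_one_le_left (Real.sqrt_nonneg _) h1
        _ = ε / 8 * W := by rw [mul_assoc, Real.mul_self_sqrt hWpos.le]
    have hqn : 0 < (Fintype.card F : ℝ) ^ n := by positivity
    have hfin : W * ‖∑ g ∈ polysLT F n, f g * χ g‖ ≤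
        W * ((Fintype.card F : ℝ) ^ n * (ε / 2)) := by
      refine hb.trans ?_
      calc _ ≤ (Fintype.card F : ℝ) ^ n * (2 * (ε / 8 * W) + 2 * (ε / 8 * W)) := by gcongr
        _ = _ := by ring
    have hS := le_of_mul_le_mul_left hfin hWpos
    rw [dist_zero_right, norm_mul, norm_div, norm_one, norm_pow, Complex.norm_natCast,
      one_div, inv_mul_lt_iff₀ hqn]
    refine hS.trans_lt ?_
    gcongr
    linarith
  · intro P hP Q hQ hne
    have hs : P - Q ≠ 0 := sub_ne_zero.2 hne
    have hk0 : k (P - Q) ∈ polysLT F (n - max P.natDegree Q.natDegree) := by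
      rw [mem_polysLT]
      refine degree_le_natDegree.trans_lt ?_
      have := hm P hP Q hQ
      have := hd P hP
      have := hd Q hQ
      exact_mod_cast (by omega : (k (P - Q)).natDegree < n - max P.natDegree Q.natDegree)
    exact sum_polysLT_eq_zero (χ.compAddMonoidHom (AddMonoidHom.mulLeft (P - Q))) hk0
      (hk _ hs)

end Katai

lemma DegLE.map_add_sub {A M : Type*} [AddCommMonoid A] [CommRing M] {l : A → M}
    (hl : DegLE l 1) (g h : A) : l (g + h) - l 0 = (l g - l 0) + (l h - l 0) := by
  have := hl ![g, h] 0
  simp [Δop] at this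
  linear_combination this

lemma degLE_one_of_map_add {A M : Type*} [AddCommMonoid A] [CommRing M] (l : A → M)
    (hl : ∀ g h, l (g + h) = l g + l h) : DegLE l 1 := by
  intro h g
  simp [Δop, hl]

section Main

variable {F : Type*} [Field F] [Fintype F]

/-- The additive character `g ↦ α (l g - l 0)` attached to a polynomial map `l` of degree at
most `1`. -/
noncomputable def charOfDegLE {F : Type*} [Field F] (l : F[X] → F) (hl : DegLE l 1) (α : F → ℂ)
    (hα : ∀ a b, α (a + b) = α a * α b) (hα1 : ∀ a, ‖α a‖ = 1) : AddChar F[X] ℂ where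
  toFun g := α (l g - l 0)
  map_zero_eq_one' := by
    have h := hα 0 0
    have h0 : α 0 ≠ 0 := norm_ne_zero_iff.1 (by rw [hα1]; exact one_ne_zero)
    rw [add_zero] at h
    rw [sub_self]
    exact (mul_eq_left₀ h0).1 h.symm
  map_add_eq_mul' g h := by rw [hl.map_add_sub, hα]

open scoped Classical in
/-- Orthogonality of the characters `ψ ∘ φ` on a finite vector space over a field. -/
lemma sum_dual_char {F V : Type*} [Field F] [AddCommGroup V] [Module F V]
    [Fintype (Module.Dual F V)] (ψ : AddChar F ℂ) (hψ : ψ ≠ 1) (v : V) :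
    ∑ φ : Module.Dual F V, ψ (φ v) = if v = 0 then (Fintype.card (Module.Dual F V) : ℂ) else 0 := by
  split_ifs with hv
  · simp [hv]
  · obtain ⟨φ, hφ⟩ := Module.Projective.exists_dual_eq_one F hv
    obtain ⟨b, hb⟩ := AddChar.ne_one_iff.1 hψ
    have hne : ψ.compAddMonoidHom (Module.Dual.eval F V v).toAddMonoidHom ≠ 0 :=
      AddChar.ne_zero_iff.2 ⟨b • φ, by simpa [hφ] using hb⟩
    exact AddChar.sum_eq_zero_iff_ne_zero.2 hne

/-- A character trivial on the ideal `(s)` is uncorrelated with an aperiodic function. -/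
lemma IsAperiodicFn.tendsto_of_periodic {f : F[X] → ℂ} (hf : IsAperiodicFn f)
    (χ : AddChar F[X] ℂ) {s : F[X]} (hs : s ≠ 0) (hper : ∀ h, χ (s * h) = 1) :
    Tendsto (fun n : ℕ => (1 / (Fintype.card F : ℂ) ^ n) * ∑ c : Fin n → F,
      f (polyOf c) * χ (polyOf c)) atTop (nhds 0) := by
  have hrep : ∀ g : F[X],
      χ (Quotient.out (Ideal.Quotient.mk (Ideal.span {s}) g)) = χ g := by
    intro g
    have hmk : Ideal.Quotient.mk (Ideal.span {s})
        (Quotient.out (Ideal.Quotient.mk (Ideal.span {s}) g)) =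
        Ideal.Quotient.mk (Ideal.span {s}) g := Quotient.out_eq _
    obtain ⟨h, hh⟩ := Ideal.mem_span_singleton.1 (Ideal.Quotient.eq.1 hmk)
    rw [sub_eq_iff_eq_add.1 hh, AddChar.map_add_eq_mul, hper, one_mul]
  simpa only [starRingEnd_self_apply, hrep] using hf s hs fun r => conj (χ (Quotient.out r))

/-- Vanishing correlations with all linear characters imply aperiodicity. -/
lemma isAperiodicFn_of_forall_linear {f : F[X] → ℂ} (ψ : AddChar F ℂ) (hψ : ψ ≠ 1)
    (hf : ∀ φ : Module.Dual F F[X],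
      Tendsto (fun n : ℕ => (1 / (Fintype.card F : ℂ) ^ n) * ∑ c : Fin n → F,
        f (polyOf c) * ψ (φ (polyOf c))) atTop (nhds 0)) : IsAperiodicFn f := by
  classical
  intro s hs a
  have : Module.Finite F (F[X] ⧸ Ideal.span {s}) := (AdjoinRoot.powerBasis hs).finite
  have : Finite (F[X] ⧸ Ideal.span {s}) := Module.finite_of_finite F
  have : Finite (Module.Dual F (F[X] ⧸ Ideal.span {s})) := Module.finite_of_finite F
  let := Fintype.ofFinite (F[X] ⧸ Ideal.span {s})
  let := Fintype.ofFinite (Module.Dual F (F[X] ⧸ Ideal.span {s}))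
  set N : ℂ := (Fintype.card (Module.Dual F (F[X] ⧸ Ideal.span {s})) : ℂ) with hN
  have hN0 : N ≠ 0 := by rw [hN]; exact Nat.cast_ne_zero.2 Fintype.card_ne_zero
  have hexp : ∀ r : F[X] ⧸ Ideal.span {s}, conj (a r) =
      ∑ t, ∑ φ : Module.Dual F (F[X] ⧸ Ideal.span {s}),
        conj (a t) * N⁻¹ * ψ (-φ t) * ψ (φ r) := by
    intro r
    have h1 : ∀ t, ∑ φ : Module.Dual F (F[X] ⧸ Ideal.span {s}),
        conj (a t) * N⁻¹ * ψ (-φ t) * ψ (φ r) = if t = r then conj (a t) else 0 := by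
      intro t
      have h2 := sum_dual_char ψ hψ (r - t)
      simp_rw [mul_assoc, ← AddChar.map_add_eq_mul, neg_add_eq_sub, ← map_sub, ← Finset.mul_sum,
        h2, sub_eq_zero, eq_comm (a := r)]
      split_ifs
      · rw [inv_mul_cancel₀ hN0, mul_one]
      · simp
    simp [h1]
  have hlim : Tendsto (fun n : ℕ => ∑ t, ∑ φ : Module.Dual F (F[X] ⧸ Ideal.span {s}),
      conj (a t) * N⁻¹ * ψ (-φ t) * ((1 / (Fintype.card F : ℂ) ^ n) * ∑ c : Fin n → F,
        f (polyOf c) * ψ (φ (Ideal.Quotient.mk (Ideal.span {s}) (polyOf c))))) atTop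
      (nhds (∑ t, ∑ φ : Module.Dual F (F[X] ⧸ Ideal.span {s}),
        conj (a t) * N⁻¹ * ψ (-φ t) * 0)) :=
    tendsto_finsetSum _ fun t _ => tendsto_finsetSum _ fun φ _ =>
      (hf (φ ∘ₗ (Ideal.Quotient.mkₐ F (Ideal.span {s})).toLinearMap)).const_mul _
  simp only [mul_zero, Finset.sum_const_zero] at hlim
  refine hlim.congr fun n => ?_
  have hexp' : ∀ g : F[X], f g * conj (a (Ideal.Quotient.mk (Ideal.span {s}) g)) =
      ∑ t, ∑ φ : Module.Dual F (F[X] ⧸ Ideal.span {s}), f g *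
        (conj (a t) * N⁻¹ * ψ (-φ t) * ψ (φ (Ideal.Quotient.mk (Ideal.span {s}) g))) := by
    intro g
    rw [hexp]
    simp_rw [Finset.mul_sum]
  simp_rw [hexp', Finset.mul_sum]
  symm
  rw [Finset.sum_comm]
  refine Finset.sum_congr rfl fun t _ => ?_
  rw [Finset.sum_comm]
  exact Finset.sum_congr rfl fun φ _ => Finset.sum_congr rfl fun c _ => by ring

end Main

theorem stmt13 {F : Type*} [Field F] [Fintype F]
    (f : Polynomial F → ℂ) (hf : IsMultFn f) (hfb : ∀ g, ‖f g‖ ≤ 1) :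
    IsAperiodicFn f ↔
      ∀ l : Polynomial F → F, DegLE l 1 →
        ∀ α : F → ℂ, (∀ a b, α (a + b) = α a * α b) → (∀ a, ‖α a‖ = 1) →
          Tendsto (fun n : ℕ => (1 / (Fintype.card F : ℂ) ^ n) *
              ∑ c : Fin n → F, f (polyOf c) * α (l (polyOf c))) atTop (nhds 0) := by
  constructor
  · intro hap l hl α hα hα1
    set χ := charOfDegLE l hl α hα hα1
    have hχn : ∀ g, ‖χ g‖ = 1 := fun g => hα1 _
    have hlχ : ∀ g, f g * α (l g) = f g * χ g * α (l 0) := fun g => by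
      rw [show χ g = α (l g - l 0) from rfl, mul_assoc, ← hα, sub_add_cancel]
    have key : Tendsto (fun n : ℕ => (1 / (Fintype.card F : ℂ) ^ n) * ∑ c : Fin n → F,
        f (polyOf c) * χ (polyOf c)) atTop (nhds 0) := by
      by_cases hper : ∃ s : F[X], s ≠ 0 ∧ ∀ h, χ (s * h) = 1
      · obtain ⟨s, hs, hsχ⟩ := hper
        exact hap.tendsto_of_periodic χ hs hsχ
      · push Not at hper
        simpa only [sum_polyOf _ fun g => f g * χ g] using
          tendsto_of_nonperiodic f hf hfb χ hχn hper
    simpa only [hlχ, ← mul_assoc, ← Finset.sum_mul, zero_mul] using key.mul_const (α (l 0))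
  · intro h
    have hprim := AddChar.FiniteField.primitiveChar_to_Complex_isPrimitive F
    refine isAperiodicFn_of_forall_linear (AddChar.FiniteField.primitiveChar_to_Complex F)
      ?_ fun φ => h φ (degLE_one_of_map_add _ (map_add φ)) _
        (AddChar.map_add_eq_mul _) fun a => AddChar.norm_apply _ a
    simpa using hprim one_ne_zero
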